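/- Let μ be a σ-invariant Borel probability measure on Σ = D^ℕ, let φ_1,…,φ_m : Σ → ℝ be continuous, let j ∈ {1,…,d} and let ε > 0. Then there exist k ∈ ℕ and a k-th level Bernoulli measure ν ∈ B_{σ^k}(Σ) such that: (i) | h_{μ∘χ_j^{−1}}(σ_j) − (1/k) h_{ν∘χ_j^{−1}}(σ_j^k) | < ε; (ii) | ∫ A_k(φ_l) dν − ∫ φ_l dμ | < ε for each l = 1,…,m; and (iii) ν([ω_1⋯ω_k]) > 0 for every word (ω_1,…,ω_k) ∈ D^k. -/

import Mathlib

open MeasureTheory Filter Topology Metric Set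
open scoped ENNReal NNReal

noncomputable section

/-- Shannon entropy of the partition of `X` induced by a map into a finite type. -/
def entPart {X : Type*} [MeasurableSpace X] (μ : Measure X) {ι : Type*} [Fintype ι]
    (p : X → ι) : ℝ :=
  ∑ i, Real.negMulLog ((μ (p ⁻¹' {i})).toReal)

/-- Kolmogorov–Sinai (measure-theoretic) entropy of `T` with respect to `μ`:
the supremum over finite measurable partitions (coded by measurable maps into `Fin m`)
of the limit (= infimum, by subadditivity) of the averaged entropies of the dynamical
refinements of the partition. -/
def ksEntropy {X : Type*} [MeasurableSpace X] (T : X → X) (μ : Measure X) : ℝ :=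
  ⨆ m : ℕ, ⨆ p : {p : X → Fin m // Measurable p},
    ⨅ n : ℕ, ((n : ℝ) + 1)⁻¹ *
      entPart μ (fun x => fun k : Fin (n + 1) => p.1 (T^[(k : ℕ)] x))

/-- Minimal number of balls of radius `r` needed to cover `s`. -/
def coverN {X : Type*} [PseudoMetricSpace X] (s : Set X) (r : ℝ) : ℕ :=
  sInf {n : ℕ | ∃ t : Finset X, t.card = n ∧ s ⊆ ⋃ x ∈ t, Metric.ball x r}

/-- Upper box (Minkowski) dimension. -/
def upperBoxDim {X : Type*} [PseudoMetricSpace X] (s : Set X) : ℝ :=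
  Filter.limsup (fun r : ℝ => Real.log (coverN s r) / Real.log r⁻¹) (nhdsWithin 0 (Set.Ioi 0))

/-- Packing dimension, via countable covers and upper box dimension. -/
def packingDim {X : Type*} [PseudoMetricSpace X] (s : Set X) : ℝ :=
  ⨅ C : {C : ℕ → Set X // s ⊆ ⋃ n, C n}, ⨆ n, upperBoxDim (C.1 n)

/-- The `n`-th empirical (Birkhoff average) measure `A_{n+1}(δ_x)` of the orbit of `x`. -/
def empirical {X : Type*} [MeasurableSpace X] (T : X → X) (x : X) (n : ℕ) : Measure X :=
  (((n : ℝ≥0∞) + 1))⁻¹ • ∑ l ∈ Finset.range (n + 1), Measure.dirac (T^[l] x)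

instance empirical_prob {X : Type*} [MeasurableSpace X] (T : X → X) (x : X) (n : ℕ) :
    IsProbabilityMeasure (empirical T x n) := by
  constructor
  have h : ∀ l : ℕ, Measure.dirac (T^[l] x) (Set.univ : Set X) = 1 := fun l => by
    simp [measure_univ]
  simp only [empirical, Measure.smul_apply, Measure.coe_finset_sum, Finset.sum_apply, h,
    Finset.sum_const, Finset.card_range, nsmul_eq_mul, mul_one, smul_eq_mul]
  rw [Nat.cast_add, Nat.cast_one, ENNReal.inv_mul_cancel] <;> simp [Nat.cast_add_one_ne_zero]

/-- The `n`-th empirical measure as a probability measure. -/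
def empiricalPM {X : Type*} [MeasurableSpace X] (T : X → X) (x : X) (n : ℕ) :
    ProbabilityMeasure X := ⟨empirical T x n, empirical_prob T x n⟩

/-- `V(x)`: the set of weak* accumulation points of the sequence of empirical measures of `x`. -/
def accPts {X : Type*} [MeasurableSpace X] [TopologicalSpace X] [OpensMeasurableSpace X]
    (T : X → X) (x : X) : Set (ProbabilityMeasure X) :=
  {μ | MapClusterPt μ atTop (fun n => empiricalPM T x n)}

/-- A probability measure is invariant for `T`. -/
def IsInvariantPM {X : Type*} [MeasurableSpace X] (T : X → X)
    (μ : ProbabilityMeasure X) : Prop :=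
  (μ : Measure X).map T = (μ : Measure X)

/-- Convexity of a set of probability measures. -/
def IsConvexPMSet {X : Type*} [MeasurableSpace X] (A : Set (ProbabilityMeasure X)) : Prop :=
  ∀ μ ∈ A, ∀ ν ∈ A, ∀ t : ℝ≥0, t ≤ 1 → ∀ ρ : ProbabilityMeasure X,
    (ρ : Measure X) = t • (μ : Measure X) + (1 - t) • (ν : Measure X) → ρ ∈ A


/-- The left shift. -/
def shiftMap {β : Type*} (ω : ℕ → β) : ℕ → β := fun n => ω (n + 1)

/-- The index set of the first `d + 1 - j` coordinates (those kept by `η_{j+1}`). -/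
def TruncIdx (d : ℕ) (j : Fin (d + 1)) : Type := {q : Fin (d + 1) // q.1 + j.1 < d + 1}

/-- `η_{j+1}` : drop the last `j` coordinates of a digit. -/
def ηmap {d : ℕ} (j : Fin (d + 1)) (v : Fin (d + 1) → ℕ) : TruncIdx d j → ℕ :=
  fun q => v q.1

/-- The symbolic space `Σ = D^ℕ` over the digit set `D`. -/
abbrev SymbSpace {d : ℕ} (D : Finset (Fin (d + 1) → ℕ)) : Type := ℕ → {v // v ∈ D}

/-- `χ_{j+1} : Σ → Σ_{j+1}`, coordinatewise application of `η_{j+1}`. -/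
def chi {d : ℕ} (D : Finset (Fin (d + 1) → ℕ)) (j : Fin (d + 1)) (ω : SymbSpace D) :
    ℕ → (TruncIdx d j → ℕ) := fun n => ηmap j (ω n).1

/-- The coding map `Π : Σ → 𝕋^{d+1}`. -/
def coding {d : ℕ} (a : Fin (d + 1) → ℕ) (D : Finset (Fin (d + 1) → ℕ)) (ω : SymbSpace D) :
    Fin (d + 1) → AddCircle (1 : ℝ) :=
  fun q => ((∑' ν : ℕ, ((ω ν).1 q : ℝ) / (a q : ℝ) ^ (ν + 1) : ℝ) : AddCircle (1 : ℝ))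

/-- The self-affine Sierpiński sponge `Λ`. -/
def sponge {d : ℕ} (a : Fin (d + 1) → ℕ) (D : Finset (Fin (d + 1) → ℕ)) :
    Set (Fin (d + 1) → AddCircle (1 : ℝ)) := Set.range (coding a D)

/-- λ-exponents `λ_k = log a_{d+1} / log a_k` (with `λ_0 = 0`), indexed by `k : ℕ`. -/
def lamN (d : ℕ) (a : Fin (d + 1) → ℕ) (k : ℕ) : ℝ :=
  if h : k ≤ d + 1 ∧ 0 < k then
    Real.log (a (Fin.last d)) / Real.log (a ⟨k - 1, by omega⟩) else 0

/-- The torus map `f`. -/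
def affineTorusMap {d : ℕ} (a : Fin (d + 1) → ℕ) (x : Fin (d + 1) → AddCircle (1 : ℝ)) :
    Fin (d + 1) → AddCircle (1 : ℝ) := fun q => a q • x q

/-- Index set for `π_{j+1}` : the coordinates `≥ j`. -/
def ProjIdx (d : ℕ) (j : Fin (d + 1)) : Type := {q : Fin (d + 1) // j ≤ q}

/-- `π_{j+1} : 𝕋^{d+1} → 𝕋^{d+1-j}`. -/
def torusProj {d : ℕ} (j : Fin (d + 1)) (x : Fin (d + 1) → AddCircle (1 : ℝ)) :
    ProjIdx d j → AddCircle (1 : ℝ) := fun q => x q.1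

/-- `f_{j+1}`, the factor map on the last coordinates. -/
def torusFactorMap {d : ℕ} (a : Fin (d + 1) → ℕ) (j : Fin (d + 1))
    (x : ProjIdx d j → AddCircle (1 : ℝ)) : ProjIdx d j → AddCircle (1 : ℝ) :=
  fun q => a q.1 • x q

/-- The spectrum combination `H_1/log a_1 + Σ_{k=2}^{d+1} (1/log a_k - 1/log a_{k-1}) H_k`. -/
def dimCombo {d : ℕ} (a : Fin (d + 1) → ℕ) (H : Fin (d + 1) → ℝ) : ℝ :=
  H 0 / Real.log (a 0) +
    ∑ i : Fin d, (1 / Real.log (a i.succ) - 1 / Real.log (a i.castSucc)) * H i.succ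


/-- The cylinder set determined by a word of length `n`. -/
def cylinderSet {β : Type*} (n : ℕ) (w : Fin n → β) : Set (ℕ → β) :=
  {ω | ∀ i : Fin n, ω i.1 = w i}

/-- The index of the `i`-th letter of the `r`-th `k`-block. -/
def blockIdx {n k : ℕ} (r : Fin n) (i : Fin k) : Fin (n * k) :=
  ⟨r.1 * k + i.1, by
    have hi := i.2
    have hr := r.2
    have h1 : r.1 * k + i.1 < (r.1 + 1) * k := by rw [add_mul, one_mul]; omega
    exact lt_of_lt_of_le h1 (Nat.mul_le_mul_right k hr)⟩

/-- `ν` is a `k`-th level Bernoulli measure: the consecutive `k`-blocks are i.i.d. -/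
def IsBernoulliBlock {β : Type*} [MeasurableSpace β] [Fintype β] (k : ℕ)
    (ν : Measure (ℕ → β)) : Prop :=
  ∃ p : (Fin k → β) → ℝ≥0∞, (∑ b, p b = 1) ∧
    ∀ n : ℕ, ∀ w : Fin (n * k) → β,
      ν (cylinderSet (n * k) w) = ∏ r : Fin n, p (fun i => w (blockIdx r i))

/-- The Birkhoff average `A_k(φ)`. -/
def birkAvg {β : Type*} (k : ℕ) (φ : (ℕ → β) → ℝ) (ω : ℕ → β) : ℝ :=
  (k : ℝ)⁻¹ * ∑ l ∈ Finset.range k, φ (shiftMap^[l] ω)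

section Entropy

set_option linter.unusedSectionVars false

variable {X ι κ : Type*} [MeasurableSpace X] {M : Measure X} [IsProbabilityMeasure M]
  [Fintype ι] [MeasurableSpace ι] [MeasurableSingletonClass ι]
  [Fintype κ] [MeasurableSpace κ] [MeasurableSingletonClass κ]

lemma integrable_comp_finite {Z : X → ι} (hZ : Measurable Z) (g : ι → ℝ) :
    Integrable (fun x => g (Z x)) M :=
  (Integrable.of_finite (μ := M.map Z)).comp_measurable hZ

lemma integral_comp_finite {Z : X → ι} (hZ : Measurable Z) (g : ι → ℝ) :
    ∫ x, g (Z x) ∂M = ∑ i, M.real (Z ⁻¹' {i}) * g i := by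
  rw [← integral_map (f := g) hZ.aemeasurable (measurable_of_finite g).aestronglyMeasurable,
    integral_fintype .of_finite]
  simp [map_measureReal_apply hZ (measurableSet_singleton _)]

lemma sum_measureReal_fiber {Z : X → ι} (hZ : Measurable Z) :
    ∑ i, M.real (Z ⁻¹' {i}) = 1 := by
  simpa using (integral_comp_finite (M := M) hZ (fun _ => (1 : ℝ))).symm

lemma entPart_eq_integral {Z : X → ι} (hZ : Measurable Z) :
    entPart M Z = ∫ x, -Real.log (M.real (Z ⁻¹' {Z x})) ∂M := by
  rw [integral_comp_finite hZ (fun i => -Real.log (M.real (Z ⁻¹' {i})))]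
  simp [entPart, Real.negMulLog, Measure.real]

lemma entPart_map {Y : Type*} [MeasurableSpace Y] {f : X → Y} (hf : Measurable f) {Z : Y → ι}
    (hZ : Measurable Z) : entPart (M.map f) Z = entPart M (Z ∘ f) := by
  simp [entPart, Measure.map_apply hf (hZ (measurableSet_singleton _)), preimage_comp]

lemma entPart_nonneg (Z : X → ι) : 0 ≤ entPart M Z :=
  Finset.sum_nonneg fun _ _ => Real.negMulLog_nonneg ENNReal.toReal_nonneg measureReal_le_one

lemma ae_fiber_pos (Z : X → ι) : ∀ᵐ x ∂M, 0 < M.real (Z ⁻¹' {Z x}) := by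
  have h : ∀ i, ∀ᵐ x ∂M, Z x = i → 0 < M.real (Z ⁻¹' {i}) := by
    intro i
    by_cases hi : M (Z ⁻¹' {i}) = 0
    · filter_upwards [measure_eq_zero_iff_ae_notMem.1 hi] with x hx hxi
      exact absurd hxi hx
    · exact .of_forall fun x _ => ENNReal.toReal_pos hi (measure_ne_top _ _)
  filter_upwards [ae_all_iff.2 h] with x hx using hx _ rfl

/-- Gibbs' inequality. -/
lemma entPart_le_integral {Z : X → ι} (hZ : Measurable Z) {Q : ι → ℝ} (hQ : ∀ i, 0 ≤ Q i)
    (hQ1 : ∑ i, Q i ≤ 1) (hpos : ∀ᵐ x ∂M, 0 < Q (Z x)) :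
    entPart M Z ≤ ∫ x, -Real.log (Q (Z x)) ∂M := by
  rw [integral_comp_finite hZ (fun i => -Real.log (Q i))]
  have hP1 := sum_measureReal_fiber (M := M) hZ
  have key : ∀ i, Real.negMulLog (M.real (Z ⁻¹' {i})) ≤
      M.real (Z ⁻¹' {i}) * -Real.log (Q i) + (Q i - M.real (Z ⁻¹' {i})) := by
    intro i
    rcases (measureReal_nonneg (μ := M) (s := Z ⁻¹' {i})).eq_or_lt with h0 | h0
    · simp [← h0, hQ i]
    · have hQi : 0 < Q i := by
        by_contra hneg
        have : M (Z ⁻¹' {i}) = 0 := by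
          refine measure_eq_zero_iff_ae_notMem.2 ?_
          filter_upwards [hpos] with x hx hxi
          exact hneg (mem_singleton_iff.1 hxi ▸ hx)
        simp [Measure.real, this] at h0
      have h1 := Real.log_le_sub_one_of_pos (div_pos hQi h0)
      rw [Real.log_div hQi.ne' h0.ne'] at h1
      have h2 := mul_le_mul_of_nonneg_left h1 h0.le
      rw [mul_sub, mul_sub, mul_div_cancel₀ _ h0.ne'] at h2
      rw [Real.negMulLog]
      linarith
  calc entPart M Z ≤ ∑ i, (M.real (Z ⁻¹' {i}) * -Real.log (Q i) + (Q i - M.real (Z ⁻¹' {i}))) :=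
        Finset.sum_le_sum fun i _ => key i
    _ ≤ _ := by rw [Finset.sum_add_distrib, Finset.sum_sub_distrib, hP1]; linarith

lemma entPart_le_of_factor {Z : X → ι} {W : X → κ} (hZ : Measurable Z) (hW : Measurable W)
    (h : ∀ x y, W x = W y → Z x = Z y) : entPart M Z ≤ entPart M W := by
  rw [entPart_eq_integral hZ, entPart_eq_integral hW]
  refine integral_mono_ae
    (integrable_comp_finite hZ fun i => -Real.log (M.real (Z ⁻¹' {i})))
    (integrable_comp_finite hW fun i => -Real.log (M.real (W ⁻¹' {i}))) ?_
  filter_upwards [ae_fiber_pos (M := M) W] with x hx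
  exact neg_le_neg (Real.log_le_log hx (measureReal_mono fun y hy => h _ _ hy))

lemma entPart_prod_le {Z : X → ι} {W : X → κ} (hZ : Measurable Z) (hW : Measurable W) :
    entPart M (fun x => (Z x, W x)) ≤ entPart M Z + entPart M W := by
  have hP1 := sum_measureReal_fiber (M := M) hZ
  have hP2 := sum_measureReal_fiber (M := M) hW
  refine (entPart_le_integral (hZ.prodMk hW)
    (Q := fun q => M.real (Z ⁻¹' {q.1}) * M.real (W ⁻¹' {q.2})) (fun q => by positivity)
    ?_ ?_).trans_eq ?_
  · simp only [Fintype.sum_prod_type]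
    rw [← Finset.sum_mul_sum, hP1, hP2, one_mul]
  · filter_upwards [ae_fiber_pos (M := M) Z, ae_fiber_pos (M := M) W] with x h1 h2
    exact mul_pos h1 h2
  · rw [entPart_eq_integral hZ, entPart_eq_integral hW, ← integral_add
      (integrable_comp_finite hZ fun i => -Real.log (M.real (Z ⁻¹' {i})))
      (integrable_comp_finite hW fun i => -Real.log (M.real (W ⁻¹' {i})))]
    refine integral_congr_ae ?_
    filter_upwards [ae_fiber_pos (M := M) Z, ae_fiber_pos (M := M) W] with x h1 h2
    rw [Real.log_mul h1.ne' h2.ne', neg_add]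

lemma entPart_comp_measurePreserving {T : X → X} (hT : MeasurePreserving T M M) {Z : X → ι}
    (hZ : Measurable Z) : entPart M (Z ∘ T) = entPart M Z := by
  rw [← entPart_map hT.measurable hZ, hT.map_eq]

lemma integral_comp_of_measurePreserving {T : X → X} (hT : MeasurePreserving T M M) {f : X → ℝ}
    (hf : AEStronglyMeasurable f M) : ∫ x, f (T x) ∂M = ∫ x, f x ∂M := by
  rw [← integral_map hT.measurable.aemeasurable (hT.map_eq.symm ▸ hf), hT.map_eq]

/-- The itinerary of length `n` of a point with respect to a labelling `p`. -/
def itin (T : X → X) (p : X → ι) (n : ℕ) (x : X) : Fin n → ι := fun i => p (T^[(i : ℕ)] x)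

lemma measurable_itin {T : X → X} (hT : Measurable T) {p : X → ι} (hp : Measurable p) (n : ℕ) :
    Measurable (itin T p n) :=
  measurable_pi_lambda _ fun i => hp.comp (hT.iterate i)

lemma subadditive_entPart_itin {T : X → X} (hT : MeasurePreserving T M M) {p : X → ι}
    (hp : Measurable p) : Subadditive fun n => entPart M (itin T p n) := by
  intro a b
  have ha := measurable_itin hT.measurable hp a
  have hb := (measurable_itin hT.measurable hp b).comp (hT.iterate a).measurable
  beta_reduce
  rw [← entPart_comp_measurePreserving (hT.iterate a) (measurable_itin hT.measurable hp b)]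
  refine le_trans (entPart_le_of_factor (measurable_itin hT.measurable hp _)
    (ha.prodMk hb) fun x y hxy => ?_) (entPart_prod_le ha hb)
  have h1 := fun i => congrFun (congrArg Prod.fst hxy) i
  have h2 := fun i => congrFun (congrArg Prod.snd hxy) i
  funext i
  by_cases hi : (i : ℕ) < a
  · exact h1 ⟨i, hi⟩
  · have := h2 ⟨i - a, by omega⟩
    simpa only [itin, Function.comp, ← Function.iterate_add_apply,
      Nat.sub_add_cancel (not_lt.1 hi)] using this

lemma bddBelow_entPart_div (T : X → X) (p : X → ι) :
    BddBelow (range fun n : ℕ => entPart M (itin T p n) / n) :=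
  ⟨0, by rintro _ ⟨n, rfl⟩; exact div_nonneg (entPart_nonneg _) n.cast_nonneg⟩

/-- The entropy rate of the finite partition coded by `p`. -/
def entRate (M : Measure X) (T : X → X) (p : X → ι) : ℝ :=
  ⨅ n : ℕ, ((n : ℝ) + 1)⁻¹ * entPart M (itin T p (n + 1))

lemma bddBelow_entRate (T : X → X) (p : X → ι) :
    BddBelow (range fun n : ℕ => ((n : ℝ) + 1)⁻¹ * entPart M (itin T p (n + 1))) :=
  ⟨0, by rintro _ ⟨n, rfl⟩; exact mul_nonneg (by positivity) (entPart_nonneg _)⟩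

lemma entRate_nonneg (T : X → X) (p : X → ι) : 0 ≤ entRate M T p :=
  Real.iInf_nonneg fun n => mul_nonneg (by positivity) (entPart_nonneg _)

lemma tendsto_entRate {T : X → X} (hT : MeasurePreserving T M M) {p : X → ι}
    (hp : Measurable p) :
    Tendsto (fun n : ℕ => entPart M (itin T p n) / n) atTop (𝓝 (entRate M T p)) := by
  have hs := subadditive_entPart_itin hT hp
  have hb := bddBelow_entPart_div (M := M) T p
  have h := hs.tendsto_lim hb
  have heq : ∀ n : ℕ, ((n : ℝ) + 1)⁻¹ * entPart M (itin T p (n + 1)) =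
      entPart M (itin T p (n + 1)) / ((n + 1 : ℕ) : ℝ) := fun n => by
    rw [div_eq_inv_mul]; push_cast; rfl
  have : hs.lim = entRate M T p := by
    refine le_antisymm (le_ciInf fun n => ?_) (ge_of_tendsto' ((tendsto_add_atTop_iff_nat 1).2 h)
      fun n => ?_)
    · rw [heq]; exact hs.lim_le_div hb n.succ_ne_zero
    · rw [← heq]; exact ciInf_le (bddBelow_entRate T p) n
  rwa [← this]

/-- The conditional probability of `p = a` given `Y = y`. -/
def condProb (M : Measure X) (p : X → κ) (Y : X → ι) (a : κ) (y : ι) : ℝ :=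
  M.real (p ⁻¹' {a} ∩ Y ⁻¹' {y}) / M.real (Y ⁻¹' {y})

/-- The conditional entropy of `p` given `Y`. -/
def condEnt (M : Measure X) (p : X → κ) (Y : X → ι) : ℝ :=
  ∫ x, -Real.log (condProb M p Y (p x) (Y x)) ∂M

lemma sum_measureReal_fiber_inter {p : X → κ} (hp : Measurable p) (s : Set X) :
    ∑ a, M.real (p ⁻¹' {a} ∩ s) = M.real s := by
  have := sum_measureReal_preimage_singleton (μ := M.restrict s) (f := p) Finset.univ
    (fun y _ => hp (measurableSet_singleton y)) (fun y _ => measure_ne_top _ _)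
  simpa [measureReal_restrict_apply, hp (measurableSet_singleton _)] using this

lemma sum_condProb_le {p : X → κ} (hp : Measurable p) (Y : X → ι) (y : ι) :
    ∑ a, condProb M p Y a y ≤ 1 := by
  simp only [condProb, ← Finset.sum_div, sum_measureReal_fiber_inter hp]
  exact div_self_le_one _

lemma condProb_nonneg (p : X → κ) (Y : X → ι) (a : κ) (y : ι) : 0 ≤ condProb M p Y a y := by
  unfold condProb; positivity

lemma preimage_pair (p : X → κ) (Y : X → ι) (a : κ) (y : ι) :
    (fun x => (p x, Y x)) ⁻¹' {(a, y)} = p ⁻¹' {a} ∩ Y ⁻¹' {y} := by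
  ext; simp

lemma ae_condProb_pos (p : X → κ) (Y : X → ι) : ∀ᵐ x ∂M, 0 < condProb M p Y (p x) (Y x) := by
  filter_upwards [ae_fiber_pos (M := M) Y, ae_fiber_pos (M := M) fun x => (p x, Y x)] with x h1 h2
  rw [preimage_pair] at h2
  exact div_pos h2 h1

lemma entPart_itin_le {T : X → X} (hT : MeasurePreserving T M M) {p : X → κ} (hp : Measurable p)
    {ξ : X → ι} (hξ : Measurable ξ) (n N : ℕ) :
    entPart M (itin T p n) ≤
      entPart M (itin T ξ (n + N)) + n * condEnt M p (itin T ξ N) := by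
  set W := itin T ξ (n + N) with hWdef
  set Y := itin T ξ N with hYdef
  have hW : Measurable W := measurable_itin hT.measurable hξ _
  have hY : Measurable Y := measurable_itin hT.measurable hξ _
  have hZ : Measurable (itin T p n) := measurable_itin hT.measurable hp _
  let win : Fin n → (Fin (n + N) → ι) → Fin N → ι :=
    fun i w j => w ⟨i + j, by omega⟩
  have hwin : ∀ i x, win i (W x) = Y (T^[(i : ℕ)] x) := by
    intro i x
    funext j
    simp only [win, hWdef, hYdef, itin, ← Function.iterate_add_apply]
    rw [add_comm]
  let Q : (Fin n → κ) × (Fin (n + N) → ι) → ℝ := fun q =>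
    M.real (W ⁻¹' {q.2}) * ∏ i, condProb M p Y (q.1 i) (win i q.2)
  have hpos : ∀ᵐ x ∂M, ∀ i : Fin n,
      0 < condProb M p Y (p (T^[(i : ℕ)] x)) (Y (T^[(i : ℕ)] x)) :=
    ae_all_iff.2 fun i => (hT.iterate i).quasiMeasurePreserving.ae (ae_condProb_pos p Y)
  have hfac : entPart M (itin T p n) ≤ entPart M (fun x => (itin T p n x, W x)) :=
    entPart_le_of_factor hZ (hZ.prodMk hW) fun x y h => congrArg Prod.fst h
  have hQ : ∀ x, Q (itin T p n x, W x) = M.real (W ⁻¹' {W x}) *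
      ∏ i : Fin n, condProb M p Y (p (T^[(i : ℕ)] x)) (Y (T^[(i : ℕ)] x)) := by
    intro x
    simp only [Q, hwin]; rfl
  have hint : ∀ i : Fin n, Integrable
      (fun x => -Real.log (condProb M p Y (p (T^[(i : ℕ)] x)) (Y (T^[(i : ℕ)] x)))) M := fun i =>
    (hT.iterate i).integrable_comp_of_integrable
      (integrable_comp_finite (hp.prodMk hY) fun q => -Real.log (condProb M p Y q.1 q.2))
  refine hfac.trans ((entPart_le_integral (hZ.prodMk hW) (Q := Q) (fun q => ?_) ?_ ?_).trans_eq ?_)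
  · exact mul_nonneg measureReal_nonneg (Finset.prod_nonneg fun i _ => condProb_nonneg _ _ _ _)
  · rw [Fintype.sum_prod_type_right]
    calc ∑ w, ∑ z, Q (z, w)
        = ∑ w, M.real (W ⁻¹' {w}) * ∏ i, ∑ a, condProb M p Y a (win i w) := by
          refine Finset.sum_congr rfl fun w _ => ?_
          rw [Finset.prod_univ_sum, Fintype.piFinset_univ, Finset.mul_sum]
      _ ≤ ∑ w, M.real (W ⁻¹' {w}) * 1 := by
          gcongr with w
          exact Finset.prod_le_one
            (fun i _ => Finset.sum_nonneg fun a _ => condProb_nonneg _ _ _ _)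
            fun i _ => sum_condProb_le hp _ _
      _ ≤ 1 := by simp [sum_measureReal_fiber hW]
  · filter_upwards [hpos, ae_fiber_pos (M := M) W] with x h1 h2
    rw [hQ]
    exact mul_pos h2 (Finset.prod_pos fun i _ => h1 i)
  · have hcond : ∀ i : Fin n, ∫ x, -Real.log (condProb M p Y (p (T^[(i : ℕ)] x))
        (Y (T^[(i : ℕ)] x))) ∂M = condEnt M p Y := by
      intro i
      exact integral_comp_of_measurePreserving (hT.iterate i)
        (integrable_comp_finite (hp.prodMk hY)
          fun q => -Real.log (condProb M p Y q.1 q.2)).aestronglyMeasurable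
    rw [entPart_eq_integral hW]
    have : (n : ℝ) * condEnt M p Y = ∑ i : Fin n, ∫ x, -Real.log (condProb M p Y
        (p (T^[(i : ℕ)] x)) (Y (T^[(i : ℕ)] x))) ∂M := by
      simp [hcond]
    rw [this, ← integral_finsetSum _ fun i _ => hint i, ← integral_add
      (integrable_comp_finite hW fun w => -Real.log (M.real (W ⁻¹' {w})))
      (integrable_finsetSum _ fun i _ => hint i)]
    refine integral_congr_ae ?_
    filter_upwards [hpos, ae_fiber_pos (M := M) W] with x h1 h2
    rw [hQ, Real.log_mul h2.ne' (Finset.prod_pos fun i _ => h1 i).ne',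
      Real.log_prod (fun i _ => (h1 i).ne'), neg_add, Finset.sum_neg_distrib]

lemma mul_neg_log_div_le {r q : ℝ} (hr : 0 ≤ r) (hrq : r ≤ q) (C : ℝ) :
    r * -Real.log (r / q) ≤ Real.exp (-C) * q + C * r ∧ r * -Real.log (r / q) ≤ q - r := by
  rcases hr.eq_or_lt with rfl | hr
  · simp [hrq]; positivity
  have hq := hr.trans_le hrq
  have h : ∀ t, 0 < t → r * Real.log t - r * Real.log (r / q) ≤ t * q - r := by
    intro t ht
    have h1 := Real.log_le_sub_one_of_pos (div_pos ht (div_pos hr hq))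
    rw [Real.log_div ht.ne' (div_pos hr hq).ne'] at h1
    have h2 := mul_le_mul_of_nonneg_left h1 hr.le
    have h3 : r * (t / (r / q) - 1) = t * q - r := by field_simp
    linarith
  have h1 := h 1 one_pos
  have h2 := h _ (Real.exp_pos (-C))
  rw [Real.log_exp] at h2
  rw [Real.log_one] at h1
  constructor <;> linarith

lemma sum_mul_neg_log_le {p : X → κ} (hp : Measurable p) {Y : X → ι} (hY : Measurable Y)
    {C : ℝ} (hC : 1 ≤ C) (a : κ) (S : Set ι) :
    ∑ y, M.real (p ⁻¹' {a} ∩ Y ⁻¹' {y}) * -Real.log (condProb M p Y a y) ≤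
      Real.exp (-C) + C * M.real (symmDiff (Y ⁻¹' S) (p ⁻¹' {a})) := by
  have h1 : Real.exp (-C) + C * M.real (symmDiff (Y ⁻¹' S) (p ⁻¹' {a})) =
      ∑ y, (Real.exp (-C) * M.real (Y ⁻¹' {y}) +
        C * M.real (Y ⁻¹' {y} ∩ symmDiff (Y ⁻¹' S) (p ⁻¹' {a}))) := by
    rw [Finset.sum_add_distrib, ← Finset.mul_sum, ← Finset.mul_sum, sum_measureReal_fiber hY,
      sum_measureReal_fiber_inter hY, mul_one]
  rw [h1]
  refine Finset.sum_le_sum fun y _ => ?_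
  have hle : M.real (p ⁻¹' {a} ∩ Y ⁻¹' {y}) ≤ M.real (Y ⁻¹' {y}) :=
    measureReal_mono inter_subset_right
  obtain ⟨ha, hb⟩ := mul_neg_log_div_le measureReal_nonneg hle C
  by_cases hy : y ∈ S
  · have hd : M.real (Y ⁻¹' {y}) - M.real (p ⁻¹' {a} ∩ Y ⁻¹' {y}) ≤
        M.real (Y ⁻¹' {y} ∩ symmDiff (Y ⁻¹' S) (p ⁻¹' {a})) := by
      rw [← measureReal_sdiff inter_subset_right
        ((hp (measurableSet_singleton _)).inter (hY (measurableSet_singleton _)))]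
      refine measureReal_mono fun x hx => ⟨hx.1, Or.inl ⟨?_, fun h => hx.2 ⟨h, hx.1⟩⟩⟩
      rw [mem_preimage, mem_singleton_iff.1 hx.1]; exact hy
    have h0 : 0 ≤ M.real (Y ⁻¹' {y} ∩ symmDiff (Y ⁻¹' S) (p ⁻¹' {a})) := measureReal_nonneg
    have h2 : 0 ≤ Real.exp (-C) * M.real (Y ⁻¹' {y}) := by positivity
    refine hb.trans ?_
    nlinarith
  · have hd : M.real (p ⁻¹' {a} ∩ Y ⁻¹' {y}) ≤
        M.real (Y ⁻¹' {y} ∩ symmDiff (Y ⁻¹' S) (p ⁻¹' {a})) := by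
      refine measureReal_mono fun x hx => ⟨hx.2, Or.inr ⟨hx.1, fun h => hy ?_⟩⟩
      rw [mem_preimage, mem_singleton_iff.1 hx.2] at h; exact h
    refine ha.trans ?_
    gcongr

/-- The sets that are determined by finitely many symbols of the `ξ`-itinerary. -/
def finiteItinSets (T : X → X) (ξ : X → ι) : Set (Set X) :=
  {s | ∃ (N : ℕ) (S : Set (Fin N → ι)), itin T ξ N ⁻¹' S = s}

lemma exists_itin_preimage_eq (T : X → X) (ξ : X → ι) {N N' : ℕ} (h : N ≤ N')
    (S : Set (Fin N → ι)) : ∃ S' : Set (Fin N' → ι), itin T ξ N' ⁻¹' S' = itin T ξ N ⁻¹' S :=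
  ⟨{w | (fun i => w (Fin.castLE h i)) ∈ S}, rfl⟩

lemma isSetRing_finiteItinSets (T : X → X) (ξ : X → ι) : IsSetRing (finiteItinSets T ξ) where
  empty_mem := ⟨0, ∅, rfl⟩
  union_mem := by
    rintro _ _ ⟨N, S, rfl⟩ ⟨N', S', rfl⟩
    obtain ⟨A, hA⟩ := exists_itin_preimage_eq T ξ (le_max_left N N') S
    obtain ⟨B, hB⟩ := exists_itin_preimage_eq T ξ (le_max_right N N') S'
    exact ⟨_, A ∪ B, by rw [preimage_union, hA, hB]⟩
  sdiff_mem := by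
    rintro _ _ ⟨N, S, rfl⟩ ⟨N', S', rfl⟩
    obtain ⟨A, hA⟩ := exists_itin_preimage_eq T ξ (le_max_left N N') S
    obtain ⟨B, hB⟩ := exists_itin_preimage_eq T ξ (le_max_right N N') S'
    exact ⟨_, A \ B, by rw [preimage_sdiff, hA, hB]⟩

lemma exists_itin_approx {T : X → X} (hT : Measurable T) {ξ : X → ι} (hξ : Measurable ξ)
    {s : Set X} (hs : MeasurableSet[MeasurableSpace.generateFrom (finiteItinSets T ξ)] s)
    {δ : ℝ} (hδ : 0 < δ) :
    ∃ (N : ℕ) (S : Set (Fin N → ι)), M.real (symmDiff (itin T ξ N ⁻¹' S) s) < δ := by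
  have hm : MeasurableSpace.generateFrom (finiteItinSets T ξ) ≤ ‹MeasurableSpace X› := by
    refine MeasurableSpace.generateFrom_le ?_
    rintro _ ⟨N, S, rfl⟩
    exact measurable_itin hT hξ N S.toFinite.measurableSet
  obtain ⟨_, ⟨N, S, rfl⟩, h⟩ := @exists_measure_symmDiff_lt_of_generateFrom_isSetRing X
    (MeasurableSpace.generateFrom (finiteItinSets T ξ)) (M.trim hm) _ (finiteItinSets T ξ)
    (isSetRing_finiteItinSets T ξ)
    ⟨{univ}, countable_singleton _, by rintro _ rfl; exact ⟨0, univ, rfl⟩, by simp⟩ rfl s hs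
    (ENNReal.ofReal δ) (by simpa using hδ)
  refine ⟨N, S, ?_⟩
  rw [trim_measurableSet_eq hm] at h
  · exact (ENNReal.lt_ofReal_iff_toReal_lt (measure_ne_top _ _)).1 h
  · have : MeasurableSet[MeasurableSpace.generateFrom (finiteItinSets T ξ)]
        (itin T ξ N ⁻¹' S) := MeasurableSpace.measurableSet_generateFrom ⟨N, S, rfl⟩
    exact MeasurableSet.symmDiff this hs

lemma exists_condEnt_le {T : X → X} (hT : Measurable T) {ξ : X → ι} (hξ : Measurable ξ)
    {p : X → κ} (hp : Measurable p)
    (hgen : ∀ a, MeasurableSet[MeasurableSpace.generateFrom (finiteItinSets T ξ)] (p ⁻¹' {a}))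
    {η : ℝ} (hη : 0 < η) : ∃ N, condEnt M p (itin T ξ N) ≤ η := by
  have hcard : (0 : ℝ) < Fintype.card κ + 1 := by positivity
  set η' := η / (2 * (Fintype.card κ + 1)) with hη'
  have hη'0 : 0 < η' := by positivity
  obtain ⟨C, hC1, hC⟩ : ∃ C : ℝ, 1 ≤ C ∧ Real.exp (-C) ≤ η' := by
    refine ⟨max 1 (-Real.log η'), le_max_left _ _, ?_⟩
    calc Real.exp (-max 1 (-Real.log η')) ≤ Real.exp (Real.log η') := by
          gcongr
          linarith [le_max_right 1 (-Real.log η')]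
      _ = η' := Real.exp_log hη'0
  have hC0 : 0 < C := by linarith
  choose N S hS using fun a => exists_itin_approx (M := M) hT hξ (hgen a) (div_pos hη'0 hC0)
  refine ⟨Finset.univ.sup N, ?_⟩
  choose S' hS' using fun a =>
    exists_itin_preimage_eq T ξ (Finset.le_sup (f := N) (Finset.mem_univ a)) (S a)
  have hY : Measurable (itin T ξ (Finset.univ.sup N)) := measurable_itin hT hξ _
  rw [condEnt, integral_comp_finite (hp.prodMk hY)
    (fun q => -Real.log (condProb M p (itin T ξ (Finset.univ.sup N)) q.1 q.2)),
    Fintype.sum_prod_type]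
  simp only [preimage_pair]
  calc _ ≤ ∑ a : κ, 2 * η' := by
        refine Finset.sum_le_sum fun a _ => (sum_mul_neg_log_le hp hY hC1 a (S' a)).trans ?_
        rw [hS']
        have := (hS a).le
        rw [le_div_iff₀ hC0] at this
        linarith
    _ ≤ η := by
        rw [Finset.sum_const, nsmul_eq_mul, Finset.card_univ]
        have : η = (Fintype.card κ + 1) * (2 * η') := by rw [hη']; field_simp
        nlinarith

/-- A partition measurable with respect to the `σ`-algebra generated by the itineraries of `ξ`
has entropy rate at most that of `ξ`. -/
lemma entRate_le_of_generating {T : X → X} (hT : MeasurePreserving T M M) {ξ : X → ι}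
    (hξ : Measurable ξ) {p : X → κ} (hp : Measurable p)
    (hgen : ∀ a, MeasurableSet[MeasurableSpace.generateFrom (finiteItinSets T ξ)] (p ⁻¹' {a})) :
    entRate M T p ≤ entRate M T ξ := by
  refine le_of_forall_pos_le_add fun η hη => ?_
  obtain ⟨N, hN⟩ := exists_condEnt_le (M := M) hT.measurable hξ hp hgen hη
  have h1 : Tendsto (fun n : ℕ => entPart M (itin T ξ (n + N)) / ((n + N : ℕ) : ℝ) *
      (((n + N : ℕ) : ℝ) / n) + η) atTop (𝓝 (entRate M T ξ * 1 + η)) := by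
    refine (Tendsto.mul ((tendsto_add_atTop_iff_nat N).2 (tendsto_entRate hT hξ)) ?_).add_const η
    have : Tendsto (fun n : ℕ => 1 + (N : ℝ) / n) atTop (𝓝 (1 + 0)) :=
      (tendsto_const_div_atTop_nhds_zero_nat (N : ℝ)).const_add 1
    rw [add_zero] at this
    refine this.congr' ?_
    filter_upwards [eventually_gt_atTop 0] with n hn
    have : (n : ℝ) ≠ 0 := by positivity
    push_cast
    field_simp
  rw [mul_one] at h1
  refine le_of_tendsto_of_tendsto (tendsto_entRate hT hp) h1 ?_
  filter_upwards [eventually_gt_atTop 0] with n hn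
  have hn' : (0 : ℝ) < n := by positivity
  have hnN : (0 : ℝ) < ((n + N : ℕ) : ℝ) := by positivity
  rw [div_mul_div_cancel₀ hnN.ne', div_le_iff₀ hn', add_mul, div_mul_cancel₀ _ hn'.ne']
  have := entPart_itin_le hT hp hξ n N
  nlinarith

lemma entRate_le_of_factor {T : X → X} (hT : Measurable T) {p : X → κ} {ξ : X → ι}
    (hp : Measurable p) (hξ : Measurable ξ) (h : ∀ x y, ξ x = ξ y → p x = p y) :
    entRate M T p ≤ entRate M T ξ := by
  refine ciInf_mono (bddBelow_entRate T p) fun n => ?_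
  gcongr
  exact entPart_le_of_factor (measurable_itin hT hp _) (measurable_itin hT hξ _)
    fun x y hxy => funext fun i => h _ _ (congrFun hxy i)

/-- Kolmogorov–Sinai: the entropy of a factor is the entropy rate of any finite partition that
generates it and is measurable with respect to it. -/
lemma ksEntropy_map_eq {Y : Type*} [MeasurableSpace Y] {π : X → Y} (hπ : Measurable π)
    {T : X → X} {S : Y → Y} (hS : Measurable S) (hsemi : Function.Semiconj π T S)
    (hT : MeasurePreserving T M M) {ξ : X → ι} (hξ : Measurable ξ)
    (hgen : Measurable[MeasurableSpace.generateFrom (finiteItinSets T ξ)] π)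
    {m : ℕ} {q : Y → Fin m} (hq : Measurable q)
    (hqξ : ∀ x y, q (π x) = q (π y) → ξ x = ξ y) :
    ksEntropy S (M.map π) = entRate M T ξ := by
  have hinner : ∀ (m : ℕ) (p : {p : Y → Fin m // Measurable p}),
      ⨅ n : ℕ, ((n : ℝ) + 1)⁻¹ *
        entPart (M.map π) (fun y => fun k : Fin (n + 1) => p.1 (S^[(k : ℕ)] y)) =
      entRate M T (p.1 ∘ π) := by
    intro m p
    refine iInf_congr fun n => ?_
    refine congrArg _ ((entPart_map hπ (measurable_itin hS p.2 (n + 1))).trans ?_)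
    congr 1
    funext x k
    exact congrArg p.1 ((hsemi.iterate_right k) x).symm
  have hle : ∀ (m : ℕ) (p : {p : Y → Fin m // Measurable p}),
      entRate M T (p.1 ∘ π) ≤ entRate M T ξ := fun m p =>
    entRate_le_of_generating hT hξ (p.2.comp hπ)
      fun a => hgen (p.2 (measurableSet_singleton a))
  have h0 : 0 ≤ entRate M T ξ := entRate_nonneg _ _
  simp only [ksEntropy, hinner]
  have hin : ∀ m : ℕ, ⨆ p : {p : Y → Fin m // Measurable p}, entRate M T (p.1 ∘ π) ≤
      entRate M T ξ := fun m => Real.iSup_le (hle m) h0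
  refine le_antisymm (Real.iSup_le hin h0) ?_
  refine le_ciSup_of_le ⟨_, by rintro _ ⟨m, rfl⟩; exact hin m⟩ m ?_
  refine le_ciSup_of_le ⟨_, by rintro _ ⟨p, rfl⟩; exact hle m p⟩ ⟨q, hq⟩ ?_
  exact entRate_le_of_factor hT.measurable hξ (hq.comp hπ) hqξ

lemma entRate_eq_entPart_of_iid {T : X → X} (hT : MeasurePreserving T M M) {ξ : X → ι}
    (hξ : Measurable ξ) (hiid : ∀ (n : ℕ) (w : Fin n → ι),
      M.real (itin T ξ n ⁻¹' {w}) = ∏ i, M.real (ξ ⁻¹' {w i})) :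
    entRate M T ξ = entPart M ξ := by
  have h : ∀ n : ℕ, entPart M (itin T ξ n) = n * entPart M ξ := by
    intro n
    have hint := integrable_comp_finite (M := M) hξ fun a => -Real.log (M.real (ξ ⁻¹' {a}))
    have hi : ∀ i : Fin n, ∫ x, -Real.log (M.real (ξ ⁻¹' {ξ (T^[(i : ℕ)] x)})) ∂M =
        entPart M ξ := fun i => by
      rw [entPart_eq_integral hξ]
      exact integral_comp_of_measurePreserving (hT.iterate i) hint.aestronglyMeasurable
    have hpos : ∀ᵐ x ∂M, ∀ i : Fin n, 0 < M.real (ξ ⁻¹' {ξ (T^[(i : ℕ)] x)}) :=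
      ae_all_iff.2 fun i => (hT.iterate i).quasiMeasurePreserving.ae (ae_fiber_pos ξ)
    rw [entPart_eq_integral (measurable_itin hT.measurable hξ n)]
    have : (n : ℝ) * entPart M ξ =
        ∑ i : Fin n, ∫ x, -Real.log (M.real (ξ ⁻¹' {ξ (T^[(i : ℕ)] x)})) ∂M := by simp [hi]
    have hinti : ∀ i ∈ Finset.univ, Integrable
        (fun x => -Real.log (M.real (ξ ⁻¹' {ξ (T^[((i : Fin n) : ℕ)] x)}))) M := fun i _ =>
      (hT.iterate i).integrable_comp_of_integrable hint
    rw [this, ← integral_finsetSum _ hinti]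
    refine integral_congr_ae ?_
    filter_upwards [hpos] with x hx
    rw [hiid]
    simp only [itin]
    rw [Real.log_prod fun i _ => (hx i).ne', Finset.sum_neg_distrib]
  refine tendsto_nhds_unique (tendsto_entRate hT hξ) (tendsto_const_nhds.congr' ?_)
  filter_upwards [eventually_gt_atTop 0] with n hn
  rw [h, mul_div_cancel_left₀]
  positivity

end Entropy

section Shift

set_option linter.unusedSectionVars false

variable {β A : Type*} [MeasurableSpace β] [MeasurableSpace A]

lemma shiftMap_iterate (l : ℕ) (ω : ℕ → β) (i : ℕ) : shiftMap^[l] ω i = ω (i + l) := by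
  induction l generalizing i with
  | zero => rfl
  | succ l ih => rw [Function.iterate_succ_apply', shiftMap, ih]; congr 1; omega

lemma measurable_shiftMap : Measurable (shiftMap (β := β)) :=
  measurable_pi_lambda _ fun n => measurable_pi_apply (n + 1)

lemma semiconj_map_shiftMap (c : β → A) :
    Function.Semiconj (fun (ω : ℕ → β) n => c (ω n)) shiftMap shiftMap := fun _ => rfl

variable [Fintype β] [MeasurableSingletonClass β] [Nonempty β] [Countable A]
  [MeasurableSingletonClass A] {M : Measure (ℕ → β)} [IsProbabilityMeasure M]

/-- The first `n` letters of a sequence, up to the identification of letters by `c`. -/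
def prefixLabel (c : β → A) (n : ℕ) (ω : ℕ → β) : Fin n → β :=
  fun i => Function.invFun c (c (ω i))

lemma measurable_prefixLabel (c : β → A) (n : ℕ) : Measurable (prefixLabel c n) :=
  measurable_pi_lambda _ fun _ =>
    (measurable_of_finite fun b => Function.invFun c (c b)).comp (measurable_pi_apply _)

lemma itin_prefixLabel (c : β → A) (k n : ℕ) (ω : ℕ → β) (r : Fin n) (i : Fin k) :
    itin shiftMap^[k] (prefixLabel c k) n ω r i = Function.invFun c (c (ω (i + k * r))) := by
  simp only [itin, prefixLabel, ← Function.iterate_mul, shiftMap_iterate]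

lemma ksEntropy_map_shift_eq_entRate (c : β → A) {k : ℕ} (hk : 0 < k)
    (hM : MeasurePreserving (shiftMap (β := β))^[k] M M) :
    ksEntropy (shiftMap (β := A))^[k] (M.map fun ω n => c (ω n)) =
      entRate M shiftMap^[k] (prefixLabel c k) := by
  have hπ : Measurable fun (ω : ℕ → β) n => c (ω n) :=
    measurable_pi_lambda _ fun n => (measurable_of_finite c).comp (measurable_pi_apply n)
  let e := Fintype.equivFin (Fin k → β)
  let q : (ℕ → A) → Fin (Fintype.card (Fin k → β)) :=
    fun y => e fun i => Function.invFun c (y i)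
  have hq : Measurable q := (measurable_of_finite e).comp <| measurable_pi_lambda _ fun i =>
    (measurable_of_countable (Function.invFun c)).comp (measurable_pi_apply _)
  refine ksEntropy_map_eq hπ (measurable_shiftMap.iterate k)
    ((semiconj_map_shiftMap c).iterate_right k) hM
    (measurable_prefixLabel c k) ?_ hq fun x y hxy => e.injective hxy
  refine @measurable_pi_lambda _ _ _ (_) _ _ fun n => ?_
  intro U _
  refine MeasurableSpace.measurableSet_generateFrom
    ⟨n / k + 1, {w | c (w (Fin.last _) ⟨n % k, Nat.mod_lt n hk⟩) ∈ U}, ?_⟩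
  ext ω
  rw [mem_preimage, mem_ofPred_eq, itin_prefixLabel, Fin.val_last, Nat.mod_add_div,
    Function.invFun_eq (f := c) ⟨_, rfl⟩, mem_preimage]

lemma tendsto_entPart_prefixLabel (c : β → A)
    (hM : MeasurePreserving (shiftMap (β := β)) M M) :
    Tendsto (fun n : ℕ => entPart M (prefixLabel c n) / n) atTop
      (𝓝 (ksEntropy shiftMap (M.map fun ω n => c (ω n)))) := by
  have h1 : MeasurePreserving (shiftMap (β := β))^[1] M M := hM
  have h := ksEntropy_map_shift_eq_entRate c one_pos h1
  rw [Function.iterate_one] at h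
  rw [h]
  have hm := measurable_prefixLabel c 1
  refine (tendsto_entRate h1 hm).congr fun n => ?_
  congr 1
  refine le_antisymm
    (entPart_le_of_factor (measurable_itin h1.measurable hm n) (measurable_prefixLabel c n)
      fun x y hxy => ?_)
    (entPart_le_of_factor (measurable_prefixLabel c n) (measurable_itin h1.measurable hm n)
      fun x y hxy => ?_)
  · funext r i
    rw [itin_prefixLabel, itin_prefixLabel]
    obtain rfl : i = 0 := Subsingleton.elim _ _
    simpa [prefixLabel] using congrFun hxy r
  · funext r
    have := congrFun (congrFun hxy r) 0
    rw [itin_prefixLabel, itin_prefixLabel] at this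
    simpa [prefixLabel] using this

/-- The `r`-th block of length `k` of a sequence. -/
def block (k r : ℕ) (ω : ℕ → β) : Fin k → β := fun i => ω (r * k + i)

/-- Concatenation of a sequence of blocks of length `k`. -/
def flatten {k : ℕ} (hk : 0 < k) (y : ℕ → Fin k → β) : ℕ → β :=
  fun m => y (m / k) ⟨m % k, Nat.mod_lt m hk⟩

lemma measurable_block (k r : ℕ) : Measurable (block (β := β) k r) :=
  measurable_pi_lambda _ fun _ => measurable_pi_apply _

lemma prefixLabel_preimage (c : β → A) (k : ℕ) (v : Fin k → β) :
    prefixLabel c k ⁻¹' {v} =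
      block k 0 ⁻¹' {b | (fun i => Function.invFun c (c (b i))) = v} := by
  ext ω
  simp [prefixLabel, block, funext_iff]

lemma measurable_flatten {k : ℕ} (hk : 0 < k) : Measurable (flatten (β := β) hk) :=
  measurable_pi_lambda _ fun _ => (measurable_pi_apply _).comp (measurable_pi_apply _)

lemma block_flatten {k : ℕ} (hk : 0 < k) (r : ℕ) (y : ℕ → Fin k → β) :
    block k r (flatten hk y) = y r := by
  funext i
  have h1 : (r * k + i) / k = r := by
    rw [mul_comm, Nat.mul_add_div hk, Nat.div_eq_of_lt i.2, add_zero]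
  have h2 : (r * k + i) % k = i := by
    rw [mul_comm, Nat.mul_add_mod, Nat.mod_eq_of_lt i.2]
  simp only [block, flatten, h1, h2]

/-- The law of a sequence whose consecutive `k`-blocks are independent with law `P`. -/
def blockMeasure {k : ℕ} (hk : 0 < k) (P : Measure (Fin k → β)) [IsProbabilityMeasure P] :
    Measure (ℕ → β) :=
  (Measure.infinitePi fun _ : ℕ => P).map (flatten hk)

section BlockMeasure

variable {k : ℕ} (hk : 0 < k) (P : Measure (Fin k → β)) [IsProbabilityMeasure P]

instance : IsProbabilityMeasure (blockMeasure hk P) :=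
  Measure.isProbabilityMeasure_map (measurable_flatten hk).aemeasurable

lemma map_shiftMap_infinitePi {α : Type*} [MeasurableSpace α] (Q : Measure α)
    [IsProbabilityMeasure Q] :
    (Measure.infinitePi fun _ : ℕ => Q).map shiftMap = Measure.infinitePi fun _ : ℕ => Q := by
  refine Measure.eq_infinitePi _ fun s t ht => ?_
  rw [Measure.map_apply measurable_shiftMap (.pi s.countable_toSet fun _ _ => ht _)]
  have : shiftMap ⁻¹' (s : Set ℕ).pi t =
      ((s.map (addRightEmbedding 1) : Finset ℕ) : Set ℕ).pi fun i => t (i - 1) := by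
    ext x; simp [shiftMap, Set.mem_pi]
  rw [this, Measure.infinitePi_pi _ fun _ _ => ht _, Finset.prod_map]
  simp

lemma map_shiftMap_blockMeasure :
    (blockMeasure hk P).map shiftMap^[k] = blockMeasure hk P := by
  rw [blockMeasure, Measure.map_map (measurable_shiftMap.iterate k) (measurable_flatten hk)]
  have : shiftMap^[k] ∘ flatten (β := β) hk = flatten hk ∘ shiftMap := by
    funext y m
    simp [shiftMap_iterate, flatten, shiftMap, Nat.add_div_right _ hk]
  rw [this, ← Measure.map_map (measurable_flatten hk) measurable_shiftMap,
    map_shiftMap_infinitePi]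

lemma blockMeasure_apply (n : ℕ) (t : Fin n → Set (Fin k → β)) :
    blockMeasure hk P {ω | ∀ r : Fin n, block k r ω ∈ t r} = ∏ r, P (t r) := by
  have hm : MeasurableSet {ω : ℕ → β | ∀ r : Fin n, block k r ω ∈ t r} := by
    rw [ofPred_forall]
    exact .iInter fun r => measurable_block k r (t r).toFinite.measurableSet
  rw [blockMeasure, Measure.map_apply (measurable_flatten hk) hm]
  let t' : ℕ → Set (Fin k → β) := fun i => if h : i < n then t ⟨i, h⟩ else univ
  have : flatten hk ⁻¹' {ω | ∀ r : Fin n, block k r ω ∈ t r} =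
      ((Finset.range n : Finset ℕ) : Set ℕ).pi t' := by
    ext y
    simp only [mem_preimage, mem_ofPred_eq, block_flatten, Set.mem_pi, Finset.coe_range, mem_Iio]
    refine ⟨fun h i hi => ?_, fun h r => ?_⟩
    · simpa [t', hi] using h ⟨i, hi⟩
    · simpa [t'] using h r r.2
  rw [this, Measure.infinitePi_pi _ fun i _ => (t' i).toFinite.measurableSet,
    Finset.prod_range]
  simp [t']

lemma blockMeasure_block_preimage (s : Set (Fin k → β)) :
    blockMeasure hk P (block k 0 ⁻¹' s) = P s := by
  have := blockMeasure_apply hk P 1 fun _ => s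
  simpa [preimage, Unique.forall_iff] using this

lemma isBernoulliBlock_blockMeasure : IsBernoulliBlock k (blockMeasure hk P) := by
  refine ⟨fun b => P {b}, by simp, fun n w => ?_⟩
  · have : cylinderSet (n * k) w =
        {ω | ∀ r : Fin n, block k r ω ∈ ({fun i => w (blockIdx r i)} : Set (Fin k → β))} := by
      ext ω
      simp only [cylinderSet, mem_ofPred_eq, mem_singleton_iff, funext_iff]
      refine ⟨fun h r i => h (blockIdx r i), fun h i => ?_⟩
      have hi : (i : ℕ) / k < n := Nat.div_lt_of_lt_mul (mul_comm n k ▸ i.2)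
      have := h ⟨i / k, hi⟩ ⟨i % k, Nat.mod_lt _ hk⟩
      have hidx : blockIdx ⟨(i : ℕ) / k, hi⟩ ⟨(i : ℕ) % k, Nat.mod_lt _ hk⟩ = i :=
        Fin.ext (Nat.div_add_mod' _ _)
      rw [hidx] at this
      simpa only [block, Nat.div_add_mod'] using this
    rw [this, blockMeasure_apply]

lemma blockMeasure_cylinderSet (w : Fin k → β) :
    blockMeasure hk P (cylinderSet k w) = P {w} := by
  rw [← blockMeasure_block_preimage hk P {w}]
  congr 1
  ext ω
  simp [cylinderSet, block, funext_iff]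

lemma ksEntropy_blockMeasure (c : β → A) :
    ksEntropy (shiftMap (β := A))^[k] ((blockMeasure hk P).map fun ω n => c (ω n)) =
      entPart (blockMeasure hk P) (prefixLabel c k) := by
  have hM : MeasurePreserving (shiftMap (β := β))^[k] (blockMeasure hk P) (blockMeasure hk P) :=
    ⟨measurable_shiftMap.iterate k, map_shiftMap_blockMeasure hk P⟩
  rw [ksEntropy_map_shift_eq_entRate c hk hM]
  refine entRate_eq_entPart_of_iid hM (measurable_prefixLabel c k) fun n w => ?_
  let lab : (Fin k → β) → Fin k → β := fun b i => Function.invFun c (c (b i))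
  have h1 : itin (shiftMap (β := β))^[k] (prefixLabel c k) n ⁻¹' {w} =
      {ω | ∀ r : Fin n, block k r ω ∈ lab ⁻¹' {w r}} := by
    ext ω
    simp only [mem_preimage, mem_singleton_iff, mem_ofPred_eq, funext_iff, itin_prefixLabel,
      lab, block]
    refine forall_congr' fun r => forall_congr' fun i => ?_
    rw [add_comm, mul_comm]
  have h2 : ∀ v, prefixLabel c k ⁻¹' {v} = block k 0 ⁻¹' (lab ⁻¹' {v}) :=
    prefixLabel_preimage c k
  simp only [Measure.real, h1, h2, blockMeasure_apply, blockMeasure_block_preimage,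
    ENNReal.toReal_prod]

end BlockMeasure

lemma exists_pos_approx {α : Type*} [Fintype α] [Nonempty α] [MeasurableSpace α]
    [MeasurableSingletonClass α] (Q : Measure α) [IsProbabilityMeasure Q] :
    ∃ P : ℕ → Measure α, (∀ n, IsProbabilityMeasure (P n)) ∧ (∀ n a, 0 < P n {a}) ∧
      ∀ s, Tendsto (fun n => (P n).real s) atTop (𝓝 (Q.real s)) := by
  let U : Measure α := ProbabilityTheory.uniformOn univ
  let δ : ℕ → ℝ := fun n => 1 / ((n : ℝ) + 1)
  have hδ0 : ∀ n, 0 < δ n := fun n => Nat.one_div_pos_of_nat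
  have hδ1 : ∀ n, 0 ≤ 1 - δ n := fun n =>
    sub_nonneg.2 ((div_le_one (by positivity)).2 (by simp))
  have hδ : Tendsto δ atTop (𝓝 0) := tendsto_one_div_add_atTop_nhds_zero_nat
  let P : ℕ → Measure α := fun n => ENNReal.ofReal (δ n) • U + ENNReal.ofReal (1 - δ n) • Q
  have : IsProbabilityMeasure U :=
    ProbabilityTheory.isProbabilityMeasure_uniformOn finite_univ univ_nonempty
  have hP : ∀ n, IsProbabilityMeasure (P n) := fun n => ⟨by
    simp [P, ← ENNReal.ofReal_add (hδ0 n).le (hδ1 n)]⟩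
  refine ⟨P, hP, fun n a => ?_, fun s => ?_⟩
  · have : 0 < U {a} := by
      simp [U, ProbabilityTheory.uniformOn_univ]
    simp [P, hδ0 n, this]
  · have h : ∀ n, (P n).real s = δ n * U.real s + (1 - δ n) * Q.real s := fun n => by
      simp [P, Measure.real, ENNReal.toReal_add, ENNReal.mul_ne_top, (hδ0 n).le, hδ1 n]
    simp only [h]
    simpa using (hδ.mul_const (U.real s)).add ((hδ.const_sub 1).mul_const (Q.real s))

section Integral

variable [TopologicalSpace β] [DiscreteTopology β]

lemma exists_abs_sub_lt_of_eq_prefix {φ : (ℕ → β) → ℝ} (hφ : Continuous φ) {ε : ℝ}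
    (hε : 0 < ε) : ∃ N : ℕ, ∀ x y : ℕ → β, (∀ i < N, x i = y i) → |φ x - φ y| < ε := by
  have hloc : ∀ x : ℕ → β, ∃ n : ℕ, ∀ y ∈ PiNat.cylinder x n, |φ y - φ x| < ε / 2 := by
    intro x
    have hmem : {y | |φ y - φ x| < ε / 2} ∈ 𝓝 x :=
      Metric.tendsto_nhds.1 (hφ.tendsto x) (ε / 2) (half_pos hε)
    obtain ⟨_, ⟨z, n, rfl⟩, hxz, hs⟩ :=
      (PiNat.isTopologicalBasis_cylinders fun _ : ℕ => β).mem_nhds_iff.1 hmem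
    exact ⟨n, fun y hy => hs (PiNat.mem_cylinder_iff_eq.1 hxz ▸ hy)⟩
  choose n hn using hloc
  obtain ⟨t, -, ht⟩ := isCompact_univ.elim_nhds_subcover (fun x => PiNat.cylinder x (n x))
    fun x _ =>
      (PiNat.isOpen_cylinder (fun _ : ℕ => β) x (n x)).mem_nhds (PiNat.self_mem_cylinder _ _)
  refine ⟨t.sup n, fun x y hxy => ?_⟩
  obtain ⟨z, hz, hxz⟩ := mem_iUnion₂.1 (ht (mem_univ x))
  have hyz : y ∈ PiNat.cylinder z (n z) := PiNat.mem_cylinder_iff.2 fun i hi => by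
    rw [← hxy i (hi.trans_le (Finset.le_sup hz)), PiNat.mem_cylinder_iff.1 hxz i hi]
  have h1 := abs_lt.1 (hn z x hxz)
  have h2 := abs_lt.1 (hn z y hyz)
  exact abs_lt.2 ⟨by linarith, by linarith⟩

lemma eventually_abs_birkAvg_sub_le {φ : (ℕ → β) → ℝ} (hφ : Continuous φ) {ε : ℝ}
    (hε : 0 < ε) : ∀ᶠ k : ℕ in atTop, ∀ x y : ℕ → β, (∀ i < k, x i = y i) →
      |birkAvg k φ x - birkAvg k φ y| ≤ ε := by
  obtain ⟨N, hN⟩ := exists_abs_sub_lt_of_eq_prefix hφ (half_pos hε)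
  obtain ⟨C, hC⟩ : ∃ C, ∀ x, |φ x| ≤ C := by
    obtain ⟨C, hC⟩ := isCompact_univ.exists_bound_of_continuousOn hφ.continuousOn
    exact ⟨C, fun x => hC x (mem_univ x)⟩
  have hC0 : 0 ≤ C := (abs_nonneg _).trans (hC (fun _ => Classical.arbitrary β))
  have hlim := (tendsto_const_div_atTop_nhds_zero_nat (2 * C * N)).eventually_le_const (half_pos hε)
  filter_upwards [hlim, eventually_gt_atTop 0] with k hk hk0 x y hxy
  have hk0' : (0 : ℝ) < k := by positivity
  have hterm : ∀ l ∈ Finset.range k, |φ (shiftMap^[l] x) - φ (shiftMap^[l] y)| ≤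
      ε / 2 + if l ∈ Finset.Ico (k - N) k then 2 * C else 0 := by
    intro l hl
    rw [Finset.mem_range] at hl
    split_ifs with h
    · have := abs_sub (φ (shiftMap^[l] x)) (φ (shiftMap^[l] y))
      linarith [hC (shiftMap^[l] x), hC (shiftMap^[l] y)]
    · rw [add_zero]
      refine (hN _ _ fun i hi => ?_).le
      rw [shiftMap_iterate, shiftMap_iterate]
      refine hxy _ ?_
      rw [Finset.mem_Ico] at h
      omega
  have hsum : ∑ l ∈ Finset.range k, |φ (shiftMap^[l] x) - φ (shiftMap^[l] y)| ≤
      k * (ε / 2) + N * (2 * C) := by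
    refine (Finset.sum_le_sum hterm).trans ?_
    rw [Finset.sum_add_distrib, Finset.sum_const, Finset.card_range, nsmul_eq_mul,
      ← Finset.sum_filter, Finset.sum_const, nsmul_eq_mul]
    gcongr
    refine (Finset.card_le_card (t := Finset.Ico (k - N) k) fun l hl => ?_).trans ?_
    · exact (Finset.mem_filter.1 hl).2
    · rw [Nat.card_Ico]; omega
  rw [birkAvg, birkAvg, ← mul_sub, ← Finset.sum_sub_distrib, abs_mul,
    abs_of_pos (inv_pos.2 hk0')]
  calc _ ≤ (k : ℝ)⁻¹ * (k * (ε / 2) + N * (2 * C)) := by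
        gcongr
        exact (Finset.abs_sum_le_sum_abs _ _).trans hsum
    _ = ε / 2 + 2 * C * N / k := by field_simp
    _ ≤ ε := by linarith

variable [BorelSpace β]

lemma continuous_shiftMap : Continuous (shiftMap (β := β)) :=
  continuous_pi fun n => continuous_apply (n + 1)

lemma continuous_birkAvg {φ : (ℕ → β) → ℝ} (hφ : Continuous φ) (k : ℕ) :
    Continuous (birkAvg k φ) :=
  continuous_const.mul <| continuous_finsetSum _ fun l _ =>
    hφ.comp (continuous_shiftMap.iterate l)

lemma integrable_of_continuous {φ : (ℕ → β) → ℝ} (hφ : Continuous φ) : Integrable φ M := by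
  obtain ⟨C, hC⟩ := isCompact_univ.exists_bound_of_continuousOn hφ.continuousOn
  exact .of_bound hφ.measurable.aestronglyMeasurable C (.of_forall fun x => hC x (mem_univ x))

lemma integral_birkAvg {φ : (ℕ → β) → ℝ} (hφ : Continuous φ)
    (hM : MeasurePreserving (shiftMap (β := β)) M M) {k : ℕ} (hk : 0 < k) :
    ∫ ω, birkAvg k φ ω ∂M = ∫ ω, φ ω ∂M := by
  have hint : ∀ l : ℕ, Integrable (fun ω => φ (shiftMap^[l] ω)) M := fun l =>
    (hM.iterate l).integrable_comp_of_integrable (integrable_of_continuous hφ)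
  simp only [birkAvg]
  rw [integral_const_mul, integral_finsetSum _ fun l _ => hint l]
  have : ∀ l : ℕ, ∫ ω, φ (shiftMap^[l] ω) ∂M = ∫ ω, φ ω ∂M := fun l =>
    integral_comp_of_measurePreserving (hM.iterate l)
      (integrable_of_continuous hφ).aestronglyMeasurable
  simp only [this, Finset.sum_const, Finset.card_range, nsmul_eq_mul]
  field_simp

/-- An arbitrary extension of a finite word to an infinite sequence. -/
def extendWord {k : ℕ} (b : Fin k → β) : ℕ → β :=
  fun n => if h : n < k then b ⟨n, h⟩ else Classical.arbitrary β

lemma abs_integral_birkAvg_sub_sum_le {φ : (ℕ → β) → ℝ} (hφ : Continuous φ) {k : ℕ} {ε : ℝ}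
    (hosc : ∀ x y : ℕ → β, (∀ i < k, x i = y i) → |birkAvg k φ x - birkAvg k φ y| ≤ ε) :
    |∫ ω, birkAvg k φ ω ∂M -
      ∑ b, M.real (block k 0 ⁻¹' {b}) * birkAvg k φ (extendWord b)| ≤ ε := by
  have hb := measurable_block (β := β) k 0
  rw [← integral_comp_finite hb fun b => birkAvg k φ (extendWord b),
    ← integral_sub (integrable_of_continuous (continuous_birkAvg hφ k))
      (integrable_comp_finite hb fun b => birkAvg k φ (extendWord b))]
  have := norm_integral_le_of_norm_le_const (μ := M) (C := ε)
    (f := fun ω => birkAvg k φ ω - birkAvg k φ (extendWord (block k 0 ω)))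
    (.of_forall fun ω => hosc _ _ fun i hi => by simp [extendWord, block, hi])
  simpa using this

lemma exists_blockMeasure_approx {m : ℕ} (hM : MeasurePreserving (shiftMap (β := β)) M M)
    (c : β → A) {φs : Fin m → (ℕ → β) → ℝ} (hφs : ∀ l, Continuous (φs l)) {ε : ℝ} (hε : 0 < ε) :
    ∃ (k : ℕ) (hk : 0 < k) (P : Measure (Fin k → β)) (_ : IsProbabilityMeasure P),
      |ksEntropy shiftMap (M.map fun ω n => c (ω n)) -
        (k : ℝ)⁻¹ * ksEntropy shiftMap^[k] ((blockMeasure hk P).map fun ω n => c (ω n))| < ε ∧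
      (∀ l, |∫ ω, birkAvg k (φs l) ω ∂(blockMeasure hk P) - ∫ ω, φs l ω ∂M| < ε) ∧
      ∀ b, 0 < P {b} := by
  have hent := Metric.tendsto_nhds.1 (tendsto_entPart_prefixLabel c hM) (ε / 2) (half_pos hε)
  have hosc := eventually_all.2 fun l =>
    eventually_abs_birkAvg_sub_le (hφs l) (by positivity : 0 < ε / 4)
  obtain ⟨k, hk1, hk2, hk⟩ := (hent.and (hosc.and (eventually_gt_atTop 0))).exists
  have hb := measurable_block (β := β) k 0
  have : IsProbabilityMeasure (M.map (block k 0)) :=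
    Measure.isProbabilityMeasure_map hb.aemeasurable
  obtain ⟨P, hP, hpos, hlim⟩ := exists_pos_approx (M.map (block (β := β) k 0))
  have hlim' : ∀ s, Tendsto (fun n => (blockMeasure hk (P n)).real (block k 0 ⁻¹' s)) atTop
      (𝓝 (M.real (block k 0 ⁻¹' s))) := by
    intro s
    simpa [Measure.real, blockMeasure_block_preimage, Measure.map_apply hb
      s.toFinite.measurableSet] using hlim s
  have hentlim : Tendsto (fun n => entPart (blockMeasure hk (P n)) (prefixLabel c k) / k) atTop
      (𝓝 (entPart M (prefixLabel c k) / k)) := by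
    refine (tendsto_finsetSum _ fun w _ => ?_).div_const _
    have h := hlim' {b | (fun i => Function.invFun c (c (b i))) = w}
    simp only [← prefixLabel_preimage] at h
    exact (Real.continuous_negMulLog.tendsto _).comp h
  have hintlim : ∀ l, Tendsto (fun n => ∑ b, (blockMeasure hk (P n)).real (block k 0 ⁻¹' {b}) *
      birkAvg k (φs l) (extendWord b)) atTop
      (𝓝 (∑ b, M.real (block k 0 ⁻¹' {b}) * birkAvg k (φs l) (extendWord b))) := fun l =>
    tendsto_finsetSum _ fun b _ => (hlim' {b}).mul_const _
  obtain ⟨n, hn1, hn2⟩ := ((Metric.tendsto_nhds.1 hentlim (ε / 2) (half_pos hε)).and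
    (eventually_all.2 fun l => Metric.tendsto_nhds.1 (hintlim l) (ε / 4) (by positivity))).exists
  refine ⟨k, hk, P n, hP n, ?_, fun l => ?_, hpos n⟩
  · rw [ksEntropy_blockMeasure, ← div_eq_inv_mul]
    rw [Real.dist_eq, abs_lt] at hk1 hn1
    exact abs_lt.2 ⟨by linarith, by linarith⟩
  · have h1 := abs_le.1 (abs_integral_birkAvg_sub_sum_le (M := M) (hφs l) (hk2 l))
    have h2 := abs_le.1 (abs_integral_birkAvg_sub_sum_le (M := blockMeasure hk (P n)) (hφs l)
      (hk2 l))
    rw [integral_birkAvg (hφs l) hM hk] at h1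
    have h3 := hn2 l
    rw [Real.dist_eq, abs_lt] at h3
    exact abs_lt.2 ⟨by linarith, by linarith⟩

end Integral

end Shift

/-- **Lemma (approximation by level-`k` Bernoulli measures).** Any shift-invariant probability
measure on `Σ` can be approximated, in projected entropy and in the integrals of finitely many
continuous potentials, by a `k`-th level Bernoulli measure giving positive mass to every
cylinder of length `k`. -/
theorem exists_bernoulli_block_approx
    {d m : ℕ} (a : Fin (d + 1) → ℕ) (ha : StrictAnti a) (ha2 : ∀ q, 2 ≤ a q)
    (D : Finset (Fin (d + 1) → ℕ)) (hD : ∀ v ∈ D, ∀ q, v q < a q) (hDne : D.Nonempty)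
    (μ : ProbabilityMeasure (SymbSpace D)) (hμ : IsInvariantPM shiftMap μ)
    (φs : Fin m → SymbSpace D → ℝ) (hφs : ∀ l, Continuous (φs l))
    (j : Fin (d + 1)) (ε : ℝ) (hε : 0 < ε) :
    ∃ k : ℕ, 0 < k ∧ ∃ ν : Measure (SymbSpace D), IsProbabilityMeasure ν ∧
      ν.map (shiftMap^[k]) = ν ∧ IsBernoulliBlock k ν ∧
      |ksEntropy shiftMap ((μ : Measure (SymbSpace D)).map (chi D j)) -
        (k : ℝ)⁻¹ * ksEntropy (shiftMap^[k]) (ν.map (chi D j))| < ε ∧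
      (∀ l : Fin m,
        |(∫ ω, birkAvg k (φs l) ω ∂ν) -
          (∫ ω, φs l ω ∂(μ : Measure (SymbSpace D)))| < ε) ∧
      (∀ w : Fin k → {v // v ∈ D}, 0 < ν (cylinderSet k w)) := by
  have : Nonempty {v // v ∈ D} := hDne.to_subtype
  have : Finite (TruncIdx d j) :=
    inferInstanceAs (Finite {q : Fin (d + 1) // q.1 + j.1 < d + 1})
  have hM : MeasurePreserving shiftMap (μ : Measure (SymbSpace D)) μ :=
    ⟨measurable_shiftMap, hμ⟩
  obtain ⟨k, hk, P, hP, hent, hint, hpos⟩ :=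
    exists_blockMeasure_approx hM (fun v => ηmap j v.1) hφs hε
  exact ⟨k, hk, blockMeasure hk P, inferInstance, map_shiftMap_blockMeasure hk P,
    isBernoulliBlock_blockMeasure hk P, hent, hint,
    fun w => (blockMeasure_cylinderSet hk P w).symm ▸ hpos w⟩

end
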